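/- For all integers m, n, t > 0 and all rational numbers x, y, the following identity holds in ℚ: Σ_{S positive (m,t)-Schröder path of height n} x^{dg(S)} · y^{cd(S)} = Σ_{P ∈ D(m,n,t)} (x+1)^{val(P)−ret(P)} · (xy)^{ret(P)}. (Note that ret(P) ≤ val(P) for every P, since every return is a valley, so the exponent val(P)−ret(P) is a nonnegative integer.) -/

import Mathlib

/-- A step of a lattice path: north `(0,1)`, east `(1,0)` or diagonal `(1,1)`. -/
inductive Step : Type
  | N : Step
  | E : Step
  | D : Step
  deriving DecidableEq

/-- The displacement vector of a step. -/
def stepVec : Step → ℤ × ℤ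
  | .N => (0, 1)
  | .E => (1, 0)
  | .D => (1, 1)

/-- The lattice point reached after the first `k` steps of the path `P` (starting at the
origin). -/
def pt (P : List Step) (k : ℕ) : ℤ × ℤ := ((P.take k).map stepVec).sum

/-- The path `P` starts with at least `t` north steps. -/
def StartsNorth (t : ℤ) (P : List Step) : Prop := List.replicate t.toNat Step.N <+: P

/-- The path `P` stays weakly above the line `x = m·y`. -/
def AboveLine (m : ℤ) (P : List Step) : Prop := ∀ k : ℕ, (pt P k).1 ≤ m * (pt P k).2

/-- An `(m,t)`-Schröder path of height `n`: a lattice path from `(0,0)` to `(mn,n)` using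
north, east and diagonal steps, starting with at least `t` north steps and never going
below the line `x = m·y`. -/
def IsSchroeder (m n t : ℤ) (P : List Step) : Prop :=
  StartsNorth t P ∧ pt P P.length = (m * n, n) ∧ AboveLine m P

/-- An `(m,t)`-Dyck path of height `n`: an `(m,t)`-Schröder path of height `n` with no
diagonal steps. -/
def IsDyck (m n t : ℤ) (P : List Step) : Prop :=
  IsSchroeder m n t P ∧ ∀ s ∈ P, s ≠ Step.D

/-- A Schröder path is small if none of its diagonal steps starts on the line `x = m·y`. -/
def IsSmall (m : ℤ) (P : List Step) : Prop :=
  ∀ j : ℕ, P[j]? = some Step.D → (pt P j).1 ≠ m * (pt P j).2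

/-- A Schröder path is positive if it touches the line `x = m·y` only at its two
endpoints. -/
def IsPositive (m : ℤ) (P : List Step) : Prop :=
  ∀ k : ℕ, 0 < k → k < P.length → (pt P k).1 ≠ m * (pt P k).2

/-- The set of indices `j` such that the `j`-th step of `P` is east and the `(j+1)`-st is
north; the corresponding valley point is `pt P (j+1)`. -/
def valleys (P : List Step) : Finset ℕ :=
  (Finset.range P.length).filter fun j => P[j]? = some Step.E ∧ P[j + 1]? = some Step.N

/-- The number of valleys of `P`. -/
def val (P : List Step) : ℕ := (valleys P).card

/-- The number of valleys of `P` whose `x`-coordinate is congruent to `i` modulo `m`. -/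
def ival (m i : ℤ) (P : List Step) : ℕ :=
  ((valleys P).filter fun j => (pt P (j + 1)).1 % m = i % m).card

/-- The set of returns of `P`: valleys of the form `(m·i, i)`. -/
def returns (m : ℤ) (P : List Step) : Finset ℕ :=
  (valleys P).filter fun j => (pt P (j + 1)).1 = m * (pt P (j + 1)).2

/-- The number of returns of `P`. -/
def ret (m : ℤ) (P : List Step) : ℕ := (returns m P).card

/-- The set of indices of diagonal steps of `P`. -/
def diags (P : List Step) : Finset ℕ :=
  (Finset.range P.length).filter fun j => P[j]? = some Step.D

/-- The number of diagonal steps of `P`. -/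
def dg (P : List Step) : ℕ := (diags P).card

/-- A Schröder path is `m`-divisible if every diagonal step ends at an `x`-coordinate
divisible by `m`. -/
def MDivisible (m : ℤ) (P : List Step) : Prop :=
  ∀ j ∈ diags P, m ∣ (pt P (j + 1)).1

/-- The number of cornered diagonal steps of `P`: diagonal steps connecting `(i·m − 1, i)`
to `(i·m, i + 1)` for some `i`. -/
def cd (m : ℤ) (P : List Step) : ℕ :=
  ((diags P).filter fun j => (pt P (j + 1)).1 = m * ((pt P (j + 1)).2 - 1)).card

/-- The generalized binomial coefficient `C(p,q) = p(p−1)⋯(p−q+1)/q!` for integers `p` and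
`q ≥ 0`, and `C(p,q) = 0` for `q < 0`. -/
def C (p q : ℤ) : ℤ :=
  if q < 0 then 0
  else if 0 ≤ p then (p.toNat.choose q.toNat : ℤ)
  else (-1) ^ q.toNat * ((q - p - 1).toNat.choose q.toNat : ℤ)

namespace SchroederDyck

open Step

theorem pt_zero (P : List Step) : pt P 0 = 0 := by simp [pt]

theorem pt_cons_succ (s : Step) (P : List Step) (k : ℕ) :
    pt (s :: P) (k + 1) = stepVec s + pt P k := by simp [pt]

/-- The change of the quantity `m·y − x` along a step. -/
def defect (m : ℤ) (s : Step) : ℤ := m * (stepVec s).2 - (stepVec s).1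

/-- `P` stays weakly above the line when it starts at a point with `m·y − x = d`. -/
def AboveFrom (m d : ℤ) (P : List Step) : Prop :=
  ∀ k : ℕ, (pt P k).1 ≤ d + m * (pt P k).2

/-- `P` has no interior point on the line when it starts at a point with `m·y − x = d`. -/
def PositiveFrom (m d : ℤ) (P : List Step) : Prop :=
  ∀ k : ℕ, 0 < k → k < P.length → (pt P k).1 ≠ d + m * (pt P k).2

theorem aboveFrom_zero {m : ℤ} {P : List Step} : AboveFrom m 0 P ↔ AboveLine m P := by
  simp [AboveFrom, AboveLine]

theorem positiveFrom_zero {m : ℤ} {P : List Step} : PositiveFrom m 0 P ↔ IsPositive m P := by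
  simp [PositiveFrom, IsPositive]

theorem AboveFrom.nonneg {m d : ℤ} {P : List Step} (h : AboveFrom m d P) : 0 ≤ d := by
  simpa [pt_zero] using h 0

theorem aboveFrom_cons {m d : ℤ} {s : Step} {P : List Step} :
    AboveFrom m d (s :: P) ↔ 0 ≤ d ∧ AboveFrom m (d + defect m s) P := by
  refine ⟨fun h => ⟨h.nonneg, fun k => ?_⟩, fun h k => ?_⟩
  · have := h (k + 1)
    simp only [pt_cons_succ, Prod.fst_add, Prod.snd_add, defect] at this ⊢
    linarith
  · cases k with
    | zero => simpa [pt_zero] using h.1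
    | succ k =>
      have := h.2 k
      simp only [pt_cons_succ, Prod.fst_add, Prod.snd_add, defect] at this ⊢
      linarith

theorem positiveFrom_nil {m d : ℤ} : PositiveFrom m d [] := by
  intro k _ hk
  simp at hk

theorem positiveFrom_cons {m d : ℤ} {s : Step} {P : List Step} :
    PositiveFrom m d (s :: P) ↔
      (P ≠ [] → d + defect m s ≠ 0) ∧ PositiveFrom m (d + defect m s) P := by
  refine ⟨fun h => ⟨fun hP h0 => ?_, fun k _ hk h0 => ?_⟩, fun h k hk hk' h0 => ?_⟩
  · refine h 1 one_pos (by simpa [List.length_pos_iff] using hP) ?_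
    simp only [pt_cons_succ, pt_zero, add_zero, defect] at h0 ⊢
    linarith
  · refine h (k + 1) k.succ_pos (by simpa using hk) ?_
    simp only [pt_cons_succ, Prod.fst_add, Prod.snd_add, defect] at h0 ⊢
    linarith
  · obtain _ | _ | k := k
    · simp at hk
    · refine h.1 (by rintro rfl; simp at hk') ?_
      simp only [zero_add, pt_cons_succ, pt_zero, add_zero, defect] at h0 ⊢
      linarith
    · refine h.2 (k + 1) k.succ_pos (by simpa using hk') ?_
      rw [pt_cons_succ] at h0
      simp only [Prod.fst_add, Prod.snd_add, defect] at h0 ⊢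
      linarith

/-- Replace every diagonal step by an east step followed by a north step. -/
def expand : List Step → List Step
  | [] => []
  | N :: S => N :: expand S
  | E :: S => E :: expand S
  | D :: S => E :: N :: expand S

theorem diagonal_notMem_expand (S : List Step) : ∀ s ∈ expand S, s ≠ D := by
  induction S using expand.induct <;> simp_all [expand]

theorem replicate_prefix_expand {k : ℕ} {S : List Step} :
    List.replicate k N <+: expand S ↔ List.replicate k N <+: S := by
  induction k generalizing S with
  | zero => simp
  | succ k ih =>
    cases S with
    | nil => simp [expand]
    | cons s S => cases s <;> simp [expand, List.replicate_succ, List.cons_prefix_cons, ih]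

theorem pt_length (P : List Step) : pt P P.length = (P.map stepVec).sum := by simp [pt]

theorem pt_length_expand (S : List Step) :
    pt (expand S) (expand S).length = pt S S.length := by
  simp only [pt_length]
  induction S using expand.induct <;> simp_all [expand, stepVec, ← add_assoc]

theorem aboveFrom_of_expand {m d : ℤ} {S : List Step} (h : AboveFrom m d (expand S)) :
    AboveFrom m d S := by
  induction S generalizing d with
  | nil => exact h
  | cons s S ih =>
    cases s <;> simp only [expand, aboveFrom_cons] at h ⊢
    · exact ⟨h.1, ih h.2⟩
    · exact ⟨h.1, ih h.2⟩
    · refine ⟨h.1, ih ?_⟩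
      convert h.2.2 using 1
      simp [defect, stepVec]
      ring

theorem aboveFrom_expand {m d : ℤ} (hm : 0 < m) {S : List Step} (h : AboveFrom m d S)
    (hpos : PositiveFrom m d S) (hd : 0 < d ∨ S.head? ≠ some D) :
    AboveFrom m d (expand S) := by
  induction S generalizing d with
  | nil => exact h
  | cons s S ih =>
    rw [positiveFrom_cons] at hpos
    rw [aboveFrom_cons] at h
    have h0 := h.2.nonneg
    cases s
    · rw [expand, aboveFrom_cons]
      refine ⟨h.1, ih h.2 hpos.2 (.inl ?_)⟩
      simp only [defect, stepVec]
      lia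
    · rw [expand, aboveFrom_cons]
      refine ⟨h.1, ih h.2 hpos.2 ?_⟩
      by_cases hS : S = []
      · simp [hS]
      · have := hpos.1 hS
        left
        lia
    · have hd : 0 < d := by simpa using hd
      rw [expand, aboveFrom_cons, aboveFrom_cons]
      have he : d + defect m E + defect m N = d + defect m D := by
        simp [defect, stepVec]
        ring
      rw [he]
      refine ⟨h.1, ?_, ih h.2 hpos.2 (.inl ?_)⟩ <;> simp only [defect, stepVec] <;> lia

/-- The paths whose expansion is a given path without diagonal steps. -/
def contractions : List Step → Finset (List Step)
  | [] => {[]}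
  | E :: N :: P =>
    (contractions P).image (fun S => E :: N :: S) ∪ (contractions P).image (fun S => D :: S)
  | s :: P => (contractions P).image (fun S => s :: S)

theorem mem_contractions {P S : List Step} (hP : ∀ s ∈ P, s ≠ D) :
    S ∈ contractions P ↔ expand S = P := by
  induction P using contractions.induct generalizing S with
  | case1 => rcases S with _ | ⟨_ | _ | _, S⟩ <;> simp [contractions, expand]
  | case2 P ih =>
    have ih := fun S => @ih S (by simp_all)
    rcases S with _ | ⟨_ | _ | _, _ | ⟨_ | _ | _, S⟩⟩ <;> simp [contractions, expand, ih]
  | case3 s P hs ih =>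
    have ih := fun S => @ih S (by simp_all)
    have hsD : s ≠ D := hP s (by simp)
    rw [contractions.eq_3 _ _ hs]
    rcases S with _ | ⟨_ | _ | _, S⟩ <;> cases s <;> simp_all [expand]
    grind

section Weights

variable (m : ℤ) (x y : ℚ)

/-- The weight of a Schröder path starting at a point with `m·y − x = d`. -/
def schroederWeight (d : ℤ) (S : List Step) : ℚ :=
  ∏ j ∈ Finset.range S.length, if S[j]? = some D then
    if d + m * (pt S (j + 1)).2 - (pt S (j + 1)).1 = m then x * y else x else 1

/-- The weight of a Dyck path starting at a point with `m·y − x = d`. -/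
def dyckWeight (d : ℤ) (P : List Step) : ℚ :=
  ∏ j ∈ Finset.range P.length, if P[j]? = some E ∧ P[j + 1]? = some N then
    if (pt P (j + 1)).1 = d + m * (pt P (j + 1)).2 then x * y else x + 1 else 1

theorem prod_ite_ite_one {ι : Type*} (s : Finset ι) (p q : ι → Prop) [DecidablePred p]
    [DecidablePred q] (a b : ℚ) :
    ∏ j ∈ s, (if p j then if q j then a else b else 1) =
      a ^ ((s.filter p).filter q).card * b ^ ((s.filter p).filter (¬ q ·)).card := by
  rw [← Finset.prod_filter, Finset.prod_ite, Finset.prod_const, Finset.prod_const]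

theorem schroederWeight_zero (S : List Step) :
    schroederWeight m x y 0 S = x ^ dg S * y ^ cd m S := by
  rw [schroederWeight, prod_ite_ite_one, mul_pow, mul_right_comm, ← pow_add,
    Finset.card_filter_add_card_filter_not, dg, cd, diags]
  congr 3
  refine Finset.filter_congr fun j _ => ?_
  constructor <;> intro h <;> linarith

theorem dyckWeight_zero (P : List Step) :
    dyckWeight m x y 0 P = (x + 1) ^ (val P - ret m P) * (x * y) ^ ret m P := by
  have h := Finset.card_filter_add_card_filter_not (s := valleys P)
    (fun j => (pt P (j + 1)).1 = m * (pt P (j + 1)).2)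
  rw [dyckWeight, prod_ite_ite_one, mul_comm, val, ret, returns, ← h, Nat.add_sub_cancel_left]
  simp [valleys]

theorem schroederWeight_nil (d : ℤ) : schroederWeight m x y d [] = 1 := by
  simp [schroederWeight]

theorem schroederWeight_cons (d : ℤ) (s : Step) (S : List Step) :
    schroederWeight m x y d (s :: S) =
      (if s = D then if d = 1 then x * y else x else 1) *
        schroederWeight m x y (d + defect m s) S := by
  rw [schroederWeight, List.length_cons, Finset.prod_range_succ', mul_comm, schroederWeight]
  congr 1
  · cases s <;> simp [pt_cons_succ, pt_zero, stepVec]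
    congr 1
    simp only [eq_iff_iff]
    constructor <;> intro h <;> linarith
  · refine Finset.prod_congr rfl fun j _ => ?_
    rw [pt_cons_succ s S (j + 1)]
    simp only [List.getElem?_cons_succ, Prod.fst_add, Prod.snd_add, defect]
    ring_nf

theorem dyckWeight_nil (d : ℤ) : dyckWeight m x y d [] = 1 := by
  simp [dyckWeight]

theorem dyckWeight_cons (d : ℤ) (s : Step) (P : List Step) :
    dyckWeight m x y d (s :: P) =
      (if s = E ∧ P.head? = some N then if d = 1 then x * y else x + 1 else 1) *
        dyckWeight m x y (d + defect m s) P := by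
  rw [dyckWeight, List.length_cons, Finset.prod_range_succ', mul_comm, dyckWeight]
  congr 1
  · cases s <;> simp [pt_cons_succ, pt_zero, stepVec, List.head?_eq_getElem?, eq_comm]
  · refine Finset.prod_congr rfl fun j _ => ?_
    rw [pt_cons_succ s P (j + 1)]
    simp only [List.getElem?_cons_succ, Prod.fst_add, Prod.snd_add, defect]
    congr 2
    simp only [eq_iff_iff]
    constructor <;> intro h <;> linarith

open Classical in
theorem sum_contractions {m : ℤ} (hm : 0 < m) {d : ℤ} {P : List Step}
    (hP : ∀ s ∈ P, s ≠ D) (h : AboveFrom m d P) :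
    ∑ S ∈ contractions P, (if PositiveFrom m d S then schroederWeight m x y d S else 0) =
      dyckWeight m x y d P := by
  induction P using contractions.induct generalizing d with
  | case1 => simp [contractions, positiveFrom_nil, schroederWeight_nil, dyckWeight_nil]
  | case2 P ih =>
    rw [aboveFrom_cons, aboveFrom_cons] at h
    obtain ⟨h0, h1, h2⟩ := h
    have he : d + defect m E + defect m N = d + defect m D := by
      simp [defect, stepVec]
      ring
    have h1' : 1 ≤ d := by simp [defect, stepVec] at h1; lia
    have hD : d + defect m D ≠ 0 := by simp [defect, stepVec]; lia
    have hE : d + defect m E = 0 ↔ d = 1 := by simp [defect, stepVec]; lia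
    rw [he] at h2
    have ih := ih (by simp_all) h2
    rw [contractions, Finset.sum_union, Finset.sum_image (by simp), Finset.sum_image (by simp)]
    · simp only [positiveFrom_cons, schroederWeight_cons, dyckWeight_cons, he, ← ih,
        ← Finset.sum_add_distrib, Finset.mul_sum]
      refine Finset.sum_congr rfl fun S _ => ?_
      by_cases hd : d = 1 <;> by_cases hS : PositiveFrom m (d + defect m D) S <;>
        simp [hD, hE, hd, hS] <;> simp_all <;> ring
    · simp [Finset.disjoint_left]
  | case3 s P hs ih =>
    rw [aboveFrom_cons] at h
    obtain ⟨h0, h1⟩ := h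
    have ih := ih (by simp_all) h1
    have hsD : s ≠ D := hP s (by simp)
    have hv : ¬ (s = E ∧ P.head? = some N) := by
      rintro ⟨rfl, hN⟩
      cases P <;> simp_all
    have hz : P ≠ [] → d + defect m s ≠ 0 := by
      intro hPn
      obtain ⟨s', P, rfl⟩ := List.exists_cons_of_ne_nil hPn
      have h2 := (aboveFrom_cons.1 h1).2.nonneg
      cases s <;> cases s' <;> simp_all [defect, stepVec] <;> lia
    have hz' : ∀ S ∈ contractions P, S ≠ [] → d + defect m s ≠ 0 := by
      intro S hS hSn
      refine hz ?_
      rintro rfl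
      simp_all [contractions]
    rw [contractions.eq_3 _ _ hs, Finset.sum_image (by simp), dyckWeight_cons, ← ih,
      if_neg hv, one_mul]
    refine Finset.sum_congr rfl fun S hS => ?_
    simp only [positiveFrom_cons, schroederWeight_cons, if_neg hsD, one_mul,
      and_iff_right (hz' S hS)]

end Weights

theorem isDyck_expand {m n t : ℤ} (hm : 0 < m) (ht : 0 < t) {S : List Step}
    (h : IsSchroeder m n t S) (hpos : IsPositive m S) : IsDyck m n t (expand S) := by
  refine ⟨⟨replicate_prefix_expand.2 h.1, (pt_length_expand S).trans h.2.1, ?_⟩,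
    diagonal_notMem_expand S⟩
  refine aboveFrom_zero.1 (aboveFrom_expand hm (aboveFrom_zero.2 h.2.2)
    (positiveFrom_zero.2 hpos) (.inr ?_))
  obtain ⟨k, hk⟩ : ∃ k, t.toNat = k + 1 := ⟨t.toNat - 1, by lia⟩
  obtain ⟨R, hR⟩ := h.1
  simp [← hR, hk, List.replicate_succ]

theorem isSchroeder_of_expand {m n t : ℤ} {S : List Step} (h : IsDyck m n t (expand S)) :
    IsSchroeder m n t S :=
  ⟨replicate_prefix_expand.1 h.1.1, (pt_length_expand S).symm.trans h.1.2.1,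
    aboveFrom_zero.1 (aboveFrom_of_expand (aboveFrom_zero.2 h.1.2.2))⟩

theorem length_le_pt (P : List Step) :
    (P.length : ℤ) ≤ (pt P P.length).1 + (pt P P.length).2 := by
  rw [pt_length]
  induction P with
  | nil => simp
  | cons s P ih => cases s <;> simp [stepVec] <;> lia

instance : Finite Step :=
  Set.finite_univ_iff.1 ((Set.toFinite {N, E, D}).subset fun s _ => by cases s <;> simp)

theorem finite_isSchroeder (m n t : ℤ) : {S : List Step | IsSchroeder m n t S}.Finite := by
  refine (List.finite_length_le Step (m * n + n).toNat).subset fun S hS => ?_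
  have := length_le_pt S
  rw [hS.2.1] at this
  simp only [Set.mem_ofPred_eq] at this ⊢
  lia

end SchroederDyck

open SchroederDyck

/-- the diagonal/cornered-diagonal generating function of positive
`(m,t)`-Schröder paths as a substitution of the valley-return generating function of
`(m,t)`-Dyck paths. -/
theorem statement19 (m n t : ℤ) (hm : 0 < m) (hn : 0 < n) (ht : 0 < t) (x y : ℚ) :
    (∑ᶠ S ∈ {S : List Step | IsSchroeder m n t S ∧ IsPositive m S},
        x ^ (dg S) * y ^ (cd m S))
      = ∑ᶠ P ∈ {P : List Step | IsDyck m n t P},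
          (x + 1) ^ (val P - ret m P) * (x * y) ^ (ret m P) := by
  classical
  have hB : {P | IsDyck m n t P}.Finite := (finite_isSchroeder m n t).subset fun P hP => hP.1
  have hA : {S | IsSchroeder m n t S ∧ IsPositive m S}.Finite :=
    (finite_isSchroeder m n t).subset fun S hS => hS.1
  rw [finsum_mem_eq_finite_toFinset_sum _ hA, finsum_mem_eq_finite_toFinset_sum _ hB,
    ← Finset.sum_fiberwise_of_maps_to (g := expand) (t := hB.toFinset)
      fun S hS => by
        have hS := hA.mem_toFinset.1 hS
        exact hB.mem_toFinset.2 (isDyck_expand hm ht hS.1 hS.2)]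
  refine Finset.sum_congr rfl fun P hP => ?_
  have hP : IsDyck m n t P := hB.mem_toFinset.1 hP
  rw [← dyckWeight_zero, ← sum_contractions x y hm hP.2 (aboveFrom_zero.2 hP.1.2.2),
    ← Finset.sum_filter]
  refine Finset.sum_congr ?_ fun S _ => (schroederWeight_zero m x y S).symm
  ext S
  simp only [Finset.mem_filter, Set.Finite.mem_toFinset, Set.mem_ofPred_eq,
    mem_contractions hP.2, positiveFrom_zero]
  refine ⟨fun h => ⟨h.2, h.1.2⟩, fun h => ⟨⟨isSchroeder_of_expand ?_, h.2⟩, h.1⟩⟩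
  rwa [h.1]
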